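/- Every endblock (leaf block) of a weak near-triangulation is a near-triangulation. -/

import Mathlib

open Set

/-- A plane graph: a finite simple graph whose vertices are points of the plane,
together with a plane embedding in which every edge is drawn as an arc (the range of an
injective path) joining its endpoints, two arcs meet only in common endpoints, and
no vertex lies on an arc other than at its endpoints. -/
structure PlaneGraph where
  verts : Set (ℝ × ℝ)
  finite_verts : verts.Finite
  Adj : (ℝ × ℝ) → (ℝ × ℝ) → Prop
  adj_symm : ∀ u v, Adj u v → Adj v u
  adj_irrefl : ∀ v, ¬ Adj v v
  adj_mem : ∀ u v, Adj u v → u ∈ verts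
  arc : (ℝ × ℝ) → (ℝ × ℝ) → Set (ℝ × ℝ)
  arc_symm : ∀ u v, arc u v = arc v u
  arc_path : ∀ u v, Adj u v → ∃ γ : Path u v, Function.Injective ⇑γ ∧ arc u v = Set.range ⇑γ
  arc_verts : ∀ u v, Adj u v → verts ∩ arc u v ⊆ {u, v}
  arc_inter : ∀ u v u' v', Adj u v → Adj u' v' → ({u, v} : Set (ℝ × ℝ)) ≠ {u', v'} →
    arc u v ∩ arc u' v' ⊆ ({u, v} : Set (ℝ × ℝ)) ∩ {u', v'}

namespace PlaneGraph

/-- The plane subgraph induced on a set of vertices, with the inherited embedding. -/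
def induce (G : PlaneGraph) (S : Set (ℝ × ℝ)) : PlaneGraph where
  verts := G.verts ∩ S
  finite_verts := G.finite_verts.subset inter_subset_left
  Adj u v := G.Adj u v ∧ u ∈ S ∧ v ∈ S
  adj_symm _ _ h := ⟨G.adj_symm _ _ h.1, h.2.2, h.2.1⟩
  adj_irrefl v h := G.adj_irrefl v h.1
  adj_mem _ _ h := ⟨G.adj_mem _ _ h.1, h.2.1⟩
  arc := G.arc
  arc_symm := G.arc_symm
  arc_path _ _ h := G.arc_path _ _ h.1
  arc_verts _ _ h := fun _ hx => G.arc_verts _ _ h.1 ⟨hx.1.1, hx.2⟩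
  arc_inter _ _ _ _ h h' hne := G.arc_inter _ _ _ _ h.1 h'.1 hne

/-- Deleting a set of vertices (together with all incident edges),
keeping the inherited embedding. -/
def delete (G : PlaneGraph) (X : Set (ℝ × ℝ)) : PlaneGraph := G.induce Xᶜ

/-- Deleting a single vertex. -/
def erase (G : PlaneGraph) (x : ℝ × ℝ) : PlaneGraph := G.delete {x}

/-- The point set of the plane drawing of `G`. -/
def drawing (G : PlaneGraph) : Set (ℝ × ℝ) :=
  G.verts ∪ ⋃ (u) (v) (_ : G.Adj u v), G.arc u v

/-- The faces of `G`: connected components of the complement of the drawing. -/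
def IsFace (G : PlaneGraph) (F : Set (ℝ × ℝ)) : Prop :=
  ∃ x, x ∉ G.drawing ∧ F = connectedComponentIn G.drawingᶜ x

/-- A vertex is external if it is incident to (i.e. lies on the boundary of)
an unbounded face. -/
def ExternalVertex (G : PlaneGraph) (v : ℝ × ℝ) : Prop :=
  v ∈ G.verts ∧ ∃ F, G.IsFace F ∧ ¬ Bornology.IsBounded F ∧ v ∈ closure F

/-- A triangle (cycle on three vertices) of `G`. -/
def IsTriangle (G : PlaneGraph) (a b c : ℝ × ℝ) : Prop :=
  a ≠ b ∧ a ≠ c ∧ b ≠ c ∧ G.Adj a b ∧ G.Adj b c ∧ G.Adj a c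

/-- `v` is contained in a triangle of `G`. -/
def InTriangle (G : PlaneGraph) (v : ℝ × ℝ) : Prop := ∃ b c, G.IsTriangle v b c

/-- The drawing of the closed curve formed by a triangle on `a`, `b`, `c`. -/
def triDrawing (G : PlaneGraph) (a b c : ℝ × ℝ) : Set (ℝ × ℝ) :=
  G.arc a b ∪ G.arc b c ∪ G.arc a c

/-- A face is triangular if its boundary is the drawing of a triangle of `G`. -/
def IsTriangularFace (G : PlaneGraph) (F : Set (ℝ × ℝ)) : Prop :=
  ∃ a b c, G.IsTriangle a b c ∧ frontier F = G.triDrawing a b c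

/-- The interior region of the closed curve drawn by a triangle: the union of the
bounded connected components of the complement of its drawing. -/
def triangleInterior (G : PlaneGraph) (a b c : ℝ × ℝ) : Set (ℝ × ℝ) :=
  {x | x ∉ G.triDrawing a b c ∧
    Bornology.IsBounded (connectedComponentIn (G.triDrawing a b c)ᶜ x)}

/-- A facial triangle: a triangle whose interior region is a face of `G`. -/
def IsFacialTriangle (G : PlaneGraph) (a b c : ℝ × ℝ) : Prop :=
  G.IsTriangle a b c ∧ G.IsFace (G.triangleInterior a b c)

/-- A weak near-triangulation: every bounded face is triangular and every vertex
is contained in a triangle. -/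
def IsWNT (G : PlaneGraph) : Prop :=
  (∀ F, G.IsFace F → Bornology.IsBounded F → G.IsTriangularFace F) ∧
  ∀ v ∈ G.verts, G.InTriangle v

/-- Reachability by walks in `G`. -/
def Reachable (G : PlaneGraph) (u v : ℝ × ℝ) : Prop := Relation.ReflTransGen G.Adj u v

/-- Connectedness of `G`. -/
def Connected (G : PlaneGraph) : Prop :=
  G.verts.Nonempty ∧ ∀ u ∈ G.verts, ∀ v ∈ G.verts, G.Reachable u v

/-- A cutvertex: a vertex whose deletion separates two other vertices. -/
def IsCutvertex (G : PlaneGraph) (v : ℝ × ℝ) : Prop :=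
  v ∈ G.verts ∧ ∃ a b, a ∈ G.verts ∧ b ∈ G.verts ∧ a ≠ v ∧ b ≠ v ∧
    G.Reachable a b ∧ ¬ (G.erase v).Reachable a b

/-- 2-connectivity: connected, on at least three vertices, with no cutvertex. -/
def TwoConnected (G : PlaneGraph) : Prop :=
  G.Connected ∧ 3 ≤ G.verts.ncard ∧ ∀ v, ¬ G.IsCutvertex v

/-- A near-triangulation: a 2-connected plane graph all of whose bounded faces
are triangular. -/
def IsNearTriangulation (G : PlaneGraph) : Prop :=
  G.TwoConnected ∧ ∀ F, G.IsFace F → Bornology.IsBounded F → G.IsTriangularFace F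

/-- A plane triangulation: a connected plane graph all of whose faces (including
the unbounded one) are triangular. -/
def IsTriangulation (G : PlaneGraph) : Prop :=
  G.Connected ∧ ∀ F, G.IsFace F → G.IsTriangularFace F

/-- A block of `G`, given by its vertex set `B`: a maximal set of vertices inducing
a connected subgraph without a cutvertex. -/
def IsBlock (G : PlaneGraph) (B : Set (ℝ × ℝ)) : Prop :=
  B ⊆ G.verts ∧ (G.induce B).Connected ∧ (∀ v, ¬ (G.induce B).IsCutvertex v) ∧
  ∀ B', B ⊆ B' → B' ⊆ G.verts → (G.induce B').Connected →
    (∀ v, ¬ (G.induce B').IsCutvertex v) → B' = B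

/-- A plane graph is outerplanar if all of its vertices are incident to the
unbounded face. -/
def IsOuterplanar (G : PlaneGraph) : Prop := ∀ v ∈ G.verts, G.ExternalVertex v

/-- A dominating set of `G`. -/
def IsDominatingSet (G : PlaneGraph) (D : Set (ℝ × ℝ)) : Prop :=
  D ⊆ G.verts ∧ ∀ v ∈ G.verts, v ∉ D → ∃ d ∈ D, G.Adj v d

/-- The domination number of `G`. -/
noncomputable def dominationNumber (G : PlaneGraph) : ℕ :=
  sInf {n | ∃ D, G.IsDominatingSet D ∧ D.ncard = n}

/-- `u` is problematic in `G` if `G − u` is not a weak near-triangulation. -/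
def Problematic (G : PlaneGraph) (u : ℝ × ℝ) : Prop := ¬ (G.erase u).IsWNT

/-- `x` is a `u`-bad vertex in `G`: a vertex of `G − u` not contained in a triangle
of `G − u`. -/
def IsBadFor (G : PlaneGraph) (u x : ℝ × ℝ) : Prop :=
  x ∈ G.verts ∧ x ≠ u ∧ ¬ (G.erase u).InTriangle x

end PlaneGraph

section Topology

variable {E : Type*}

/-- A preconnected set meeting an open set without being contained in it meets its frontier. -/
theorem IsPreconnected.inter_frontier_nonempty_of_isOpen [TopologicalSpace E] {S U : Set E}
    (hS : IsPreconnected S) (hU : IsOpen U) (hne : (S ∩ U).Nonempty) (hSU : ¬ S ⊆ U) :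
    (S ∩ frontier U).Nonempty := by
  by_contra h
  refine hSU (hS.subset_left_of_subset_union hU isClosed_closure.isOpen_compl
    (disjoint_compl_right.mono_left subset_closure) (fun y hy => ?_) hne)
  by_contra hy'
  simp only [mem_union, mem_compl_iff, not_or, not_not] at hy'
  exact h ⟨y, hy, hy'.2, hU.interior_eq.symm ▸ hy'.1⟩

theorem frontier_connectedComponentIn_subset [TopologicalSpace E] [LocallyConnectedSpace E]
    {D : Set E} (hD : IsClosed D) (x : E) : frontier (connectedComponentIn Dᶜ x) ⊆ D := by
  intro y hy
  by_contra hyD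
  have hopen (z : E) : IsOpen (connectedComponentIn Dᶜ z) := hD.isOpen_compl.connectedComponentIn
  obtain ⟨z, hzy, hzx⟩ := mem_closure_iff.1 hy.1 _ (hopen y) (mem_connectedComponentIn hyD)
  apply hy.2
  rw [(hopen x).interior_eq, connectedComponentIn_eq hzx, ← connectedComponentIn_eq hzy]
  exact mem_connectedComponentIn hyD

variable [NormedAddCommGroup E] [NormedSpace ℝ E]

theorem IsOpen.not_subsingleton_frontier_of_isBounded (hE : 1 < Module.rank ℝ E) {U : Set E}
    (hU : IsOpen U) (hne : U.Nonempty) (hb : Bornology.IsBounded U) :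
    ¬ (frontier U).Subsingleton := by
  intro hs
  have : Nontrivial E := (rank_pos_iff_nontrivial (R := ℝ)).1 (zero_lt_one.trans hE)
  have hfr : (frontier U).Nonempty := nonempty_frontier_iff.2
    ⟨hne, fun h => NormedSpace.unbounded_univ ℝ E (h ▸ hb)⟩
  obtain ⟨p, hp⟩ := hfr
  have hpU : p ∉ U := fun h => hp.2 (by rwa [hU.interior_eq])
  have hsub : ({p}ᶜ : Set E) ⊆ U := by
    by_contra hn
    obtain ⟨y, hy⟩ := hne
    obtain ⟨q, hq, hq'⟩ := (isConnected_compl_singleton_of_one_lt_rank hE p).isPreconnected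
      |>.inter_frontier_nonempty_of_isOpen hU ⟨y, fun h => hpU (h ▸ hy), hy⟩ hn
    exact hq (hs hq' hp)
  refine NormedSpace.unbounded_univ ℝ E ((hb.union Bornology.isBounded_singleton).subset
    (t := U ∪ {p}) fun y _ => ?_)
  by_cases h : y = p
  · exact Or.inr h
  · exact Or.inl (hsub h)

/-- If two closed sets meet in at most one point and the second one enters a bounded component of
the complement of the first one, then that component contains a component of the complement
of the union whose frontier meets each of the two sets outside the other one. -/
theorem exists_frontier_connectedComponentIn_meets_both (hE : 1 < Module.rank ℝ E) {D K : Set E}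
    (hD : IsClosed D) (hK : IsClosed K) (hDK : (D ∩ K).Subsingleton) {x : E}
    (hx : x ∉ D) (hb : Bornology.IsBounded (connectedComponentIn Dᶜ x))
    (hne : (connectedComponentIn Dᶜ x ∩ K).Nonempty) :
    ∃ q, q ∉ D ∪ K ∧ connectedComponentIn (D ∪ K)ᶜ q ⊆ connectedComponentIn Dᶜ x ∧
      (frontier (connectedComponentIn (D ∪ K)ᶜ q) ∩ (K \ D)).Nonempty ∧
      (frontier (connectedComponentIn (D ∪ K)ᶜ q) ∩ (D \ K)).Nonempty := by
  set F := connectedComponentIn Dᶜ x with hF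
  set C := connectedComponentIn (D ∪ K)ᶜ
  have hDK' : IsClosed (D ∪ K) := hD.union hK
  have hFo : IsOpen F := hD.isOpen_compl.connectedComponentIn
  have hFD : F ⊆ Dᶜ := connectedComponentIn_subset _ _
  have hCo (z : E) : IsOpen (C z) := hDK'.isOpen_compl.connectedComponentIn
  have hCs (z : E) : C z ⊆ (D ∪ K)ᶜ := connectedComponentIn_subset _ _
  have hCm {z : E} (hz : z ∉ D ∪ K) : z ∈ C z := mem_connectedComponentIn hz
  have hCF {z : E} (hz : z ∈ F) : C z ⊆ F := by
    rw [hF, connectedComponentIn_eq hz]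
    exact connectedComponentIn_mono _ (compl_subset_compl.2 subset_union_left)
  have hCfr (z : E) : frontier (C z) ⊆ D ∪ K := frontier_connectedComponentIn_subset hDK' z
  have hKfr {z : E} (hz : z ∈ F) (hzK : z ∉ K) : (frontier (C z) ∩ (K \ D)).Nonempty := by
    let P : E → Prop := fun y => y ∈ K ∨ (frontier (C y) ∩ (K \ D)).Nonempty
    have hU : IsOpen {y ∈ F | P y} := by
      refine Metric.isOpen_iff.2 ?_
      rintro y ⟨hy, hyP⟩
      by_cases hyK : y ∈ K
      · obtain ⟨ε, hε, hball⟩ := Metric.isOpen_iff.1 hFo y hy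
        refine ⟨ε, hε, fun w hw => ⟨hball hw, ?_⟩⟩
        by_cases hwK : w ∈ K
        · exact Or.inl hwK
        · have hwC : w ∈ C w := hCm fun h => h.elim (hFD (hball hw)) hwK
          obtain ⟨r, hr, hr'⟩ :=
            (convex_ball y ε).isPreconnected.inter_frontier_nonempty_of_isOpen (hCo w)
              ⟨w, hw, hwC⟩ fun h => hCs w (h (Metric.mem_ball_self hε)) (Or.inr hyK)
          have hrD : r ∉ D := hFD (hball hr)
          exact Or.inr ⟨r, hr', (hCfr w hr').resolve_left hrD, hrD⟩
      · have hyC : y ∈ C y := hCm fun h => h.elim (hFD hy) hyK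
        obtain ⟨ε, hε, hball⟩ := Metric.isOpen_iff.1 (hCo y) y hyC
        refine ⟨ε, hε, fun w hw => ⟨hCF hy (hball hw), Or.inr ?_⟩⟩
        have : C y = C w := connectedComponentIn_eq (hball hw)
        exact this ▸ hyP.resolve_left hyK
    have hV : IsOpen {y ∈ F | ¬ P y} := by
      refine Metric.isOpen_iff.2 ?_
      rintro y ⟨hy, hyP⟩
      have hyK : y ∉ K := fun h => hyP (Or.inl h)
      have hyC : y ∈ C y := hCm fun h => h.elim (hFD hy) hyK
      obtain ⟨ε, hε, hball⟩ := Metric.isOpen_iff.1 (hCo y) y hyC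
      refine ⟨ε, hε, fun w hw => ⟨hCF hy (hball hw), fun hwP => hyP (Or.inr ?_)⟩⟩
      have : C y = C w := connectedComponentIn_eq (hball hw)
      exact this ▸ hwP.resolve_left fun h => hCs y (hball hw) (Or.inr h)
    have hsub : F ⊆ {y ∈ F | P y} := by
      obtain ⟨k, hk, hkK⟩ := hne
      refine IsPreconnected.subset_left_of_subset_union hU hV
        (disjoint_left.2 fun y h h' => h'.2 h.2) (fun y hy => ?_) ⟨k, hk, hk, Or.inl hkK⟩
        isPreconnected_connectedComponentIn
      by_cases h : P y
      · exact Or.inl ⟨hy, h⟩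
      · exact Or.inr ⟨hy, h⟩
    exact (hsub hz).2.resolve_left hzK
  have hFfr : frontier F ⊆ D := frontier_connectedComponentIn_subset hD x
  obtain ⟨p, hp, hpK⟩ : ∃ p ∈ frontier F, p ∉ K := by
    by_contra! h
    exact hFo.not_subsingleton_frontier_of_isBounded hE ⟨x, mem_connectedComponentIn hx⟩ hb
      (hDK.anti fun y hy => ⟨hFfr hy, h y hy⟩)
  obtain ⟨ε, hε, hball⟩ := Metric.isOpen_iff.1 hK.isOpen_compl p hpK
  obtain ⟨q, hq, hqF⟩ := mem_closure_iff.1 hp.1 _ Metric.isOpen_ball (Metric.mem_ball_self hε)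
  have hqDK : q ∉ D ∪ K := fun h => h.elim (hFD hqF) (hball hq)
  refine ⟨q, hqDK, hCF hqF, hKfr hqF (hball hq), ?_⟩
  obtain ⟨r, hr, hr'⟩ := (convex_ball p ε).isPreconnected.inter_frontier_nonempty_of_isOpen
    (hCo q) ⟨q, hq, hCm hqDK⟩ fun h => hCs q (h (Metric.mem_ball_self hε)) (Or.inl (hFfr hp))
  exact ⟨r, hr', (hCfr q hr').resolve_right (hball hr), hball hr⟩

end Topology

namespace PlaneGraph

variable {G : PlaneGraph} {B : Set (ℝ × ℝ)}

theorem adj_mem_right {u v : ℝ × ℝ} (h : G.Adj u v) : v ∈ G.verts :=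
  G.adj_mem _ _ (G.adj_symm _ _ h)

theorem Reachable.symm {u v : ℝ × ℝ} (h : G.Reachable u v) : G.Reachable v u :=
  (@Relation.ReflTransGen.stdSymm _ _ ⟨G.adj_symm⟩).symm _ _ h

theorem Reachable.mono {H : PlaneGraph} {u v : ℝ × ℝ} (h : G.Reachable u v)
    (hGH : ∀ u v, G.Adj u v → H.Adj u v) : H.Reachable u v :=
  Relation.ReflTransGen.mono hGH _ _ h

theorem Reachable.trans {u v w : ℝ × ℝ} (huv : G.Reachable u v)
    (hvw : G.Reachable v w) : G.Reachable u w :=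
  Relation.ReflTransGen.trans huv hvw

/-- The union of the arcs of the edges satisfying `P`. -/
def arcUnion (G : PlaneGraph) (P : ℝ × ℝ → ℝ × ℝ → Prop) : Set (ℝ × ℝ) :=
  {x | ∃ u v, G.Adj u v ∧ P u v ∧ x ∈ G.arc u v}

theorem isClosed_arc {u v : ℝ × ℝ} (h : G.Adj u v) : IsClosed (G.arc u v) := by
  obtain ⟨γ, -, hγ⟩ := G.arc_path u v h
  exact hγ ▸ (isCompact_range γ.continuous).isClosed

theorem left_mem_arc {u v : ℝ × ℝ} (h : G.Adj u v) : u ∈ G.arc u v := by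
  obtain ⟨γ, -, hγ⟩ := G.arc_path u v h
  exact hγ ▸ ⟨0, γ.source⟩

theorem right_mem_arc {u v : ℝ × ℝ} (h : G.Adj u v) : v ∈ G.arc u v := by
  obtain ⟨γ, -, hγ⟩ := G.arc_path u v h
  exact hγ ▸ ⟨1, γ.target⟩

theorem isClosed_arcUnion (P : ℝ × ℝ → ℝ × ℝ → Prop) : IsClosed (G.arcUnion P) := by
  have hfin : {e : (ℝ × ℝ) × (ℝ × ℝ) | G.Adj e.1 e.2 ∧ P e.1 e.2}.Finite :=
    (G.finite_verts.prod G.finite_verts).subset fun e he =>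
      ⟨G.adj_mem _ _ he.1, adj_mem_right he.1⟩
  have : G.arcUnion P = ⋃ e ∈ {e : (ℝ × ℝ) × (ℝ × ℝ) | G.Adj e.1 e.2 ∧ P e.1 e.2},
      G.arc e.1 e.2 := by
    ext x
    simp [arcUnion, and_assoc]
  rw [this]
  exact hfin.isClosed_biUnion fun e he => isClosed_arc he.1

/-- The part of the drawing of `G` made of the vertices and edges that are not in `G.induce B`. -/
def outerDrawing (G : PlaneGraph) (B : Set (ℝ × ℝ)) : Set (ℝ × ℝ) :=
  G.verts \ B ∪ G.arcUnion fun u v => ¬ (u ∈ B ∧ v ∈ B)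

theorem isClosed_outerDrawing : IsClosed (G.outerDrawing B) :=
  (G.finite_verts.subset sdiff_subset).isClosed.union (isClosed_arcUnion _)

theorem drawing_induce :
    (G.induce B).drawing = G.verts ∩ B ∪ G.arcUnion fun u v => u ∈ B ∧ v ∈ B := by
  ext x
  simp [drawing, induce, arcUnion, and_assoc]

theorem isClosed_drawing_induce : IsClosed (G.induce B).drawing := by
  rw [drawing_induce]
  exact (G.finite_verts.subset inter_subset_left).isClosed.union (isClosed_arcUnion _)

theorem drawing_eq_union : G.drawing = (G.induce B).drawing ∪ G.outerDrawing B := by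
  rw [drawing_induce]
  ext x
  simp only [drawing, outerDrawing, arcUnion, mem_union, mem_iUnion, mem_inter_iff, mem_sdiff,
    mem_ofPred_eq, exists_prop]
  constructor
  · rintro (h | ⟨u, v, h, hx⟩)
    · by_cases hxB : x ∈ B
      · exact Or.inl (Or.inl ⟨h, hxB⟩)
      · exact Or.inr (Or.inl ⟨h, hxB⟩)
    · by_cases huv : u ∈ B ∧ v ∈ B
      · exact Or.inl (Or.inr ⟨u, v, h, huv, hx⟩)
      · exact Or.inr (Or.inr ⟨u, v, h, huv, hx⟩)
  · rintro ((h | ⟨u, v, h, -, hx⟩) | (h | ⟨u, v, h, -, hx⟩))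
    · exact Or.inl h.1
    · exact Or.inr ⟨u, v, h, hx⟩
    · exact Or.inl h.1
    · exact Or.inr ⟨u, v, h, hx⟩

theorem mem_of_mem_drawing_induce {v : ℝ × ℝ} (hv : v ∈ G.verts)
    (h : v ∈ (G.induce B).drawing) : v ∈ B := by
  rw [drawing_induce] at h
  obtain h | ⟨u, w, huw, hB, hx⟩ := h
  · exact h.2
  · obtain rfl | rfl := G.arc_verts u w huw ⟨hv, hx⟩
    exacts [hB.1, hB.2]

/-- The drawings inside and outside of `B` meet only in attachment vertices of `B`. -/
theorem exists_adj_of_mem_drawing_induce_of_mem_outerDrawing {x : ℝ × ℝ}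
    (h : x ∈ (G.induce B).drawing) (h' : x ∈ G.outerDrawing B) :
    x ∈ B ∧ ∃ a, a ∉ B ∧ G.Adj x a := by
  obtain hx | ⟨u, v, huv, hnB, hx⟩ := h'
  · exact absurd (mem_of_mem_drawing_induce hx.1 h) hx.2
  suffices hxuv : x ∈ B ∧ (x = u ∨ x = v) by
    refine ⟨hxuv.1, ?_⟩
    obtain ⟨hxB, rfl | rfl⟩ := hxuv
    · exact ⟨v, fun hv => hnB ⟨hxB, hv⟩, huv⟩
    · exact ⟨u, fun hu => hnB ⟨hu, hxB⟩, G.adj_symm _ _ huv⟩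
  rw [drawing_induce] at h
  obtain h | ⟨u', v', huv', hB, hx'⟩ := h
  · exact ⟨h.2, G.arc_verts u v huv ⟨h.1, hx⟩⟩
  · have hne : ({u, v} : Set (ℝ × ℝ)) ≠ {u', v'} := by
      intro he
      have hu : u ∈ ({u', v'} : Set (ℝ × ℝ)) := he ▸ Or.inl rfl
      have hv : v ∈ ({u', v'} : Set (ℝ × ℝ)) := he ▸ Or.inr rfl
      apply hnB
      constructor
      · obtain rfl | rfl := hu
        exacts [hB.1, hB.2]
      · obtain rfl | rfl := hv
        exacts [hB.1, hB.2]
    have hmem := G.arc_inter u v u' v' huv huv' hne ⟨hx, hx'⟩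
    refine ⟨?_, hmem.1⟩
    obtain rfl | rfl := hmem.2
    exacts [hB.1, hB.2]

theorem erase_induce_adj {v a b : ℝ × ℝ} (h : G.Adj a b) (ha : a ∈ B) (hb : b ∈ B)
    (hav : a ≠ v) (hbv : b ≠ v) : ((G.induce B).erase v).Adj a b :=
  ⟨⟨h, ha, hb⟩, hav, hbv⟩

theorem Reachable.mono_erase_induce {B' : Set (ℝ × ℝ)} (hBB' : B ⊆ B') {v a b : ℝ × ℝ}
    (h : ((G.induce B).erase v).Reachable a b) : ((G.induce B').erase v).Reachable a b :=
  h.mono fun _ _ h => ⟨⟨h.1.1, hBB' h.1.2.1, hBB' h.1.2.2⟩, h.2⟩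

theorem Reachable.of_erase {v a b : ℝ × ℝ} (h : (G.erase v).Reachable a b) : G.Reachable a b :=
  h.mono fun _ _ h => h.1

theorem IsBlock.reachable_erase (hB : G.IsBlock B) {v a b : ℝ × ℝ} (ha : a ∈ B) (hb : b ∈ B)
    (hav : a ≠ v) (hbv : b ≠ v) : ((G.induce B).erase v).Reachable a b := by
  have haB : a ∈ (G.induce B).verts := ⟨hB.1 ha, ha⟩
  have hbB : b ∈ (G.induce B).verts := ⟨hB.1 hb, hb⟩
  have hab := hB.2.1.2 a haB b hbB
  by_cases hv : v ∈ B
  · by_contra h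
    exact hB.2.2.1 v ⟨⟨hB.1 hv, hv⟩, a, b, haB, hbB, hav, hbv, hab, h⟩
  · exact hab.mono fun _ _ h => ⟨h, fun hx => hv (hx ▸ h.2.1), fun hy => hv (hy ▸ h.2.2)⟩

/-- A path both of whose distinct ends lie in a block is contained in the block. -/
theorem IsBlock.path_mem (hB : G.IsBlock B) {f : ℕ → ℝ × ℝ} {n : ℕ}
    (hf : ∀ i < n, G.Adj (f i) (f (i + 1))) (hinj : InjOn f (Iic n))
    (h0 : f 0 ∈ B) (hn : f n ∈ B) (hne : f 0 ≠ f n) {i : ℕ} (hi : i ≤ n) : f i ∈ B := by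
  set B' := B ∪ f '' Iic n
  have hBB' : B ⊆ B' := subset_union_left
  have hfB' {j : ℕ} (hj : j ≤ n) : f j ∈ B' := Or.inr ⟨j, hj, rfl⟩
  have hup (v : ℝ × ℝ) (j : ℕ) (hj : j ≤ n) (hv : ∀ k, j ≤ k → k ≤ n → f k ≠ v) :
      ((G.induce B').erase v).Reachable (f j) (f n) := by
    induction hj using Nat.decreasingInduction with
    | self => exact Relation.ReflTransGen.refl
    | of_succ k hk ih =>
      exact (ih fun l hl => hv l (by omega)).head (erase_induce_adj (hf k hk) (hfB' hk.le)
        (hfB' hk) (hv k le_rfl hk.le) (hv _ (Nat.le_succ k) hk))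
  have hdown (v : ℝ × ℝ) (j : ℕ) (hj : j ≤ n) (hv : ∀ k ≤ j, f k ≠ v) :
      ((G.induce B').erase v).Reachable (f 0) (f j) := by
    induction j with
    | zero => exact Relation.ReflTransGen.refl
    | succ k ih =>
      exact (ih (by omega) fun l hl => hv l (by omega)).tail (erase_induce_adj (hf k hj)
        (hfB' (by omega)) (hfB' hj) (hv k (by omega)) (hv _ le_rfl))
  have hto (v a : ℝ × ℝ) (ha : a ∈ B') (hav : a ≠ v) :
      ∃ b ∈ B, b ≠ v ∧ ((G.induce B').erase v).Reachable a b := by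
    obtain ha | ⟨j, hj, rfl⟩ := ha
    · exact ⟨a, ha, hav, Relation.ReflTransGen.refl⟩
    have hj : j ≤ n := hj
    by_cases h : ∃ k ≤ j, f k = v
    · obtain ⟨k, hk, rfl⟩ := h
      have hv (l : ℕ) (hl : j ≤ l) (hln : l ≤ n) : f l ≠ f k := fun he => by
        have h1 : l = k := hinj hln (hk.trans hj : k ≤ n) he
        have h2 : j = k := by omega
        exact hav (h2 ▸ rfl)
      exact ⟨f n, hn, hv n hj le_rfl, hup _ j hj hv⟩
    · push Not at h
      exact ⟨f 0, h0, h 0 (Nat.zero_le j), (hdown v j hj h).symm⟩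
  have hreach (v a b : ℝ × ℝ) (ha : a ∈ B') (hb : b ∈ B') (hav : a ≠ v) (hbv : b ≠ v) :
      ((G.induce B').erase v).Reachable a b := by
    obtain ⟨a', ha', hav', haa'⟩ := hto v a ha hav
    obtain ⟨b', hb', hbv', hbb'⟩ := hto v b hb hbv
    exact haa'.trans
      (((hB.reachable_erase ha' hb' hav' hbv').mono_erase_induce hBB').trans hbb'.symm)
  have hverts : B' ⊆ G.verts := by
    rintro _ (h | ⟨j, hj, rfl⟩)
    · exact hB.1 h
    · obtain hj | rfl := lt_or_eq_of_le (show j ≤ n from hj)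
      · exact G.adj_mem _ _ (hf j hj)
      · exact hB.1 hn
  have heq : B' = B := by
    refine hB.2.2.2 B' hBB' hverts ⟨⟨f 0, hB.1 h0, hBB' h0⟩, fun a ha b hb => ?_⟩ ?_
    · obtain ⟨v, hv⟩ := (G.finite_verts).exists_notMem
      exact (hreach v a b ha.2 hb.2 (fun h => hv (h ▸ ha.1)) fun h => hv (h ▸ hb.1)).of_erase
    · rintro v ⟨-, a, b, ha, hb, hav, hbv, -, hab⟩
      exact hab (hreach v a b ha.2 hb.2 hav hbv)
  exact heq ▸ hfB' hi

theorem IsBlock.exists_ne_of_adj (hB : G.IsBlock B) {a b : ℝ × ℝ} (hb : b ∈ B)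
    (hab : G.Adj b a) : ∃ c ∈ B, c ≠ b := by
  by_contra! hc
  have hba : b ≠ a := fun h => G.adj_irrefl a (h ▸ hab)
  have hBsub : B ⊆ {b, a} := fun c h => Or.inl (hc c h)
  have hadj : (G.induce {b, a}).Adj b a := ⟨hab, Or.inl rfl, Or.inr rfl⟩
  have heq : {b, a} = B := by
    refine hB.2.2.2 _ hBsub ?_ ⟨⟨b, hB.1 hb, Or.inl rfl⟩, ?_⟩ ?_
    · rintro _ (rfl | rfl)
      exacts [hB.1 hb, adj_mem_right hab]
    · rintro _ ⟨-, rfl | rfl⟩ _ ⟨-, rfl | rfl⟩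
      · exact Relation.ReflTransGen.refl
      · exact .single hadj
      · exact .single ((G.induce _).adj_symm _ _ hadj)
      · exact Relation.ReflTransGen.refl
    · rintro v ⟨⟨-, hv⟩, x, y, ⟨-, hx⟩, ⟨-, hy⟩, hxv, hyv, -, hxy⟩
      have : x = y := by
        simp only [mem_insert_iff, mem_singleton_iff] at hv hx hy
        grind
      exact hxy (this ▸ Relation.ReflTransGen.refl)
  exact hba (hc a (heq ▸ Or.inr rfl)).symm

theorem Reachable.exists_path {u v : ℝ × ℝ} (h : G.Reachable u v) :
    ∃ (f : ℕ → ℝ × ℝ) (n : ℕ), (∀ i < n, G.Adj (f i) (f (i + 1))) ∧ InjOn f (Iic n) ∧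
      f 0 = u ∧ f n = v := by
  classical
  have hwalk : ∃ n, ∃ f : ℕ → ℝ × ℝ, (∀ i < n, G.Adj (f i) (f (i + 1))) ∧ f 0 = u ∧ f n = v := by
    induction h with
    | refl => exact ⟨0, fun _ => u, by simp, rfl, rfl⟩
    | @tail b c _ hbc ih =>
      obtain ⟨n, f, hf, h0, hn⟩ := ih
      refine ⟨n + 1, fun k => if k ≤ n then f k else c, fun i hi => ?_, by simpa using h0, by simp⟩
      obtain hi | rfl := lt_or_eq_of_le (Nat.lt_succ_iff.1 hi)
      · simpa [hi.le, Nat.succ_le_of_lt hi] using hf i hi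
      · simpa [hn] using hbc
  obtain ⟨f, hf, h0, hn⟩ := Nat.find_spec hwalk
  refine ⟨f, Nat.find hwalk, hf, ?_, h0, hn⟩
  have key (i j : ℕ) (hij : i < j) (hj : j ≤ Nat.find hwalk) : f i ≠ f j := by
    intro he
    refine Nat.find_min hwalk (m := Nat.find hwalk - (j - i)) (by omega)
      ⟨fun k => if k ≤ i then f k else f (k + (j - i)), fun k hk => ?_, by simpa using h0, ?_⟩
    · obtain hki | rfl | hki := lt_trichotomy k i
      · simpa [hki.le, Nat.succ_le_of_lt hki] using hf k (by omega)
      · have h1 : k + 1 + (j - k) = j + 1 := by omega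
        simpa [h1, he] using hf j (by omega)
      · have h1 : ¬ k ≤ i := by omega
        have h2 : ¬ k + 1 ≤ i := by omega
        have h3 : k + 1 + (j - i) = k + (j - i) + 1 := by omega
        simpa only [h1, h2, h3, if_false] using hf (k + (j - i)) (by omega)
    · by_cases h1 : Nat.find hwalk - (j - i) ≤ i
      · have h2 : Nat.find hwalk = j := by omega
        have h3 : Nat.find hwalk - (j - i) = i := by omega
        simp only [h3, le_refl, if_true]
        rw [he, ← h2, hn]
      · have h2 : Nat.find hwalk - (j - i) + (j - i) = Nat.find hwalk := by omega
        simpa only [h1, h2, if_false] using hn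
  intro i hi j hj he
  by_contra hne
  obtain h | h := lt_or_gt_of_ne hne
  · exact key i j h hj he
  · exact key j i h hi he.symm

/-- The neighbours of a vertex of a block that is not a cutvertex belong to the block. -/
theorem IsBlock.mem_of_adj (hB : G.IsBlock B) {a b : ℝ × ℝ} (hb : b ∈ B)
    (hcut : ¬ G.IsCutvertex b) (hba : G.Adj b a) : a ∈ B := by
  obtain ⟨c, hc, hcb⟩ := hB.exists_ne_of_adj hb hba
  have hab : a ≠ b := fun h => G.adj_irrefl b (h ▸ hba)
  have hbc : G.Reachable b c :=
    (hB.2.1.2 b ⟨hB.1 hb, hb⟩ c ⟨hB.1 hc, hc⟩).mono fun _ _ h => h.1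
  have hac : (G.erase b).Reachable a c := by
    by_contra h
    exact hcut ⟨hB.1 hb, a, c, adj_mem_right hba, hB.1 hc, hab, hcb,
      Relation.ReflTransGen.head (G.adj_symm _ _ hba) hbc, h⟩
  obtain ⟨f, n, hf, hinj, h0, hn⟩ := hac.exists_path
  have hfb (i : ℕ) (hi : i ≤ n) : f i ≠ b := by
    obtain hi | rfl := lt_or_eq_of_le hi
    · exact (hf i hi).2.1
    · exact hn ▸ hcb
  let g : ℕ → ℝ × ℝ := fun k => Nat.casesOn k b f
  have hg : ∀ i < n + 1, G.Adj (g i) (g (i + 1)) := by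
    rintro (_ | i) hi
    · change G.Adj b (f 0)
      exact h0 ▸ hba
    · exact (hf i (by omega)).1
  have hginj : InjOn g (Iic (n + 1)) := by
    rintro (_ | i) hi (_ | j) hj he
    · rfl
    · exact absurd he.symm (hfb j (by simpa using hj))
    · exact absurd he (hfb i (by simpa using hi))
    · rw [hinj (by simpa using hi) (by simpa using hj) he]
  have := hB.path_mem hg hginj hb (show f n ∈ B from hn ▸ hc) (show b ≠ f n from hn ▸ hcb.symm)
    (i := 1) (by omega)
  exact h0 ▸ this

theorem IsTriangularFace.induce {F : Set (ℝ × ℝ)} (hF : G.IsTriangularFace F)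
    (h : frontier F ⊆ (G.induce B).drawing) : (G.induce B).IsTriangularFace F := by
  obtain ⟨a, b, c, ⟨hab, hac, hbc, eab, ebc, eac⟩, hfr⟩ := hF
  have ha : a ∈ B := mem_of_mem_drawing_induce (G.adj_mem _ _ eab)
    (h (hfr ▸ Or.inl (Or.inl (left_mem_arc eab))))
  have hb : b ∈ B := mem_of_mem_drawing_induce (G.adj_mem _ _ ebc)
    (h (hfr ▸ Or.inl (Or.inl (right_mem_arc eab))))
  have hc : c ∈ B := mem_of_mem_drawing_induce (adj_mem_right ebc)
    (h (hfr ▸ Or.inl (Or.inr (right_mem_arc ebc))))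
  exact ⟨a, b, c, ⟨hab, hac, hbc, ⟨eab, ha, hb⟩, ⟨ebc, hb, hc⟩, eac, ha, hc⟩, hfr⟩

/-- A point of a triangle lies on an edge joining two of its three corners. -/
theorem IsTriangle.exists_edge {a b c x : ℝ × ℝ} (h : G.IsTriangle a b c)
    (hx : x ∈ G.triDrawing a b c) :
    ∃ u ∈ ({a, b, c} : Set (ℝ × ℝ)), ∃ v ∈ ({a, b, c} : Set (ℝ × ℝ)),
      G.Adj u v ∧ x ∈ G.arc u v := by
  obtain ⟨-, -, -, eab, ebc, eac⟩ := h
  obtain (hx | hx) | hx := hx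
  · exact ⟨a, by simp, b, by simp, eab, hx⟩
  · exact ⟨b, by simp, c, by simp, ebc, hx⟩
  · exact ⟨a, by simp, c, by simp, eac, hx⟩

theorem IsTriangle.adj_of_mem {a b c u v : ℝ × ℝ} (h : G.IsTriangle a b c)
    (hu : u ∈ ({a, b, c} : Set (ℝ × ℝ))) (hv : v ∈ ({a, b, c} : Set (ℝ × ℝ))) (huv : u ≠ v) :
    G.Adj u v := by
  obtain ⟨-, -, -, eab, ebc, eac⟩ := h
  obtain rfl | rfl | rfl := hu <;> obtain rfl | rfl | rfl := hv <;>
    first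
      | exact absurd rfl huv
      | assumption
      | exact G.adj_symm _ _ ‹_›

/-- The drawing of a triangle with points drawn only inside and points drawn only outside of `B`
uses two distinct vertices of `B` having a common neighbour outside `B`. -/
theorem IsTriangle.exists_common_adj {a b c k p : ℝ × ℝ} (h : G.IsTriangle a b c)
    (hk : k ∈ G.triDrawing a b c) (hkB : k ∉ (G.induce B).drawing)
    (hp : p ∈ G.triDrawing a b c) (hpB : p ∉ G.outerDrawing B) :
    ∃ w, w ∉ B ∧ ∃ u ∈ B, ∃ v ∈ B, u ≠ v ∧ G.Adj u w ∧ G.Adj v w := by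
  obtain ⟨u, hu, v, hv, huv, hpuv⟩ := h.exists_edge hp
  obtain ⟨u', hu', v', hv', huv', hkuv⟩ := h.exists_edge hk
  have hB : u ∈ B ∧ v ∈ B := by
    by_contra hn
    exact hpB (Or.inr ⟨u, v, huv, hn, hpuv⟩)
  have hB' : ¬ (u' ∈ B ∧ v' ∈ B) := fun hn => by
    rw [drawing_induce] at hkB
    exact hkB (Or.inr ⟨u', v', huv', hn, hkuv⟩)
  obtain ⟨w, hw, hwB⟩ : ∃ w ∈ ({a, b, c} : Set (ℝ × ℝ)), w ∉ B := by
    by_contra! hn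
    exact hB' ⟨hn u' hu', hn v' hv'⟩
  exact ⟨w, hwB, u, hB.1, v, hB.2, fun he => G.adj_irrefl v (he ▸ huv),
    h.adj_of_mem hu hw fun he => hwB (he ▸ hB.1), h.adj_of_mem hv hw fun he => hwB (he ▸ hB.2)⟩

theorem IsBlock.three_le_ncard (hB : G.IsBlock B) (htri : ∀ v ∈ G.verts, G.InTriangle v)
    (hend : {v ∈ B | G.IsCutvertex v}.Subsingleton) : 3 ≤ (G.induce B).verts.ncard := by
  have hmin : ∃ b ∈ B, ¬ G.IsCutvertex b := by
    by_contra! h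
    obtain ⟨b, hbv, hb⟩ := hB.2.1.1
    obtain ⟨c, d, -, -, -, hbc, -⟩ := htri b hbv
    obtain ⟨e, he, heb⟩ := hB.exists_ne_of_adj hb hbc
    exact heb (hend ⟨he, h e he⟩ ⟨hb, h b hb⟩)
  obtain ⟨b, hb, hcut⟩ := hmin
  obtain ⟨c, d, hbc, hbd, hcd, ebc, -, ebd⟩ := htri b (hB.1 hb)
  have hc := hB.mem_of_adj hb hcut ebc
  have hd := hB.mem_of_adj hb hcut ebd
  refine (two_lt_ncard_iff (G.induce B).finite_verts).2
    ⟨b, c, d, ⟨hB.1 hb, hb⟩, ⟨hB.1 hc, hc⟩, ⟨hB.1 hd, hd⟩, hbc, hbd, hcd⟩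

end PlaneGraph

open PlaneGraph in
/-- Every endblock (a block containing at most one cutvertex of the graph) of a weak
near-triangulation is a near-triangulation. -/
theorem WNT_endblock (G : PlaneGraph) (hG : G.IsWNT)
    (B : Set (ℝ × ℝ)) (hB : G.IsBlock B)
    (hend : {v ∈ B | G.IsCutvertex v}.Subsingleton) :
    (G.induce B).IsNearTriangulation := by
  refine ⟨⟨hB.2.1, hB.three_le_ncard hG.2 hend, hB.2.2.1⟩, ?_⟩
  rintro F ⟨x, hx, rfl⟩ hb
  have hD : IsClosed (G.induce B).drawing := isClosed_drawing_induce
  have hfr := frontier_connectedComponentIn_subset hD x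
  by_cases hne : (connectedComponentIn (G.induce B).drawingᶜ x ∩ G.outerDrawing B).Nonempty
  · have hsub : ((G.induce B).drawing ∩ G.outerDrawing B).Subsingleton := by
      refine hend.anti fun y hy => ?_
      obtain ⟨hyB, a, ha, hya⟩ :=
        exists_adj_of_mem_drawing_induce_of_mem_outerDrawing hy.1 hy.2
      refine ⟨hyB, ?_⟩
      by_contra hcut
      exact ha (hB.mem_of_adj hyB hcut hya)
    obtain ⟨q, hq, hqF, ⟨k, hk, hkK, hkD⟩, p, hp, hpD, hpK⟩ :=
      exists_frontier_connectedComponentIn_meets_both (by simp; norm_num) hD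
        isClosed_outerDrawing hsub hx hb hne
    rw [← drawing_eq_union] at hq hqF hk hp
    obtain ⟨a, b, c, habc, htri⟩ := hG.1 _ ⟨q, hq, rfl⟩ (hb.subset hqF)
    rw [htri] at hk hp
    obtain ⟨w, hw, u, hu, v, hv, huv, huw, hvw⟩ := habc.exists_common_adj hk hkD hp hpK
    have hcut {z : ℝ × ℝ} (hz : z ∈ B) (hzw : G.Adj z w) : G.IsCutvertex z := by
      by_contra h
      exact hw (hB.mem_of_adj hz h hzw)
    exact absurd (hend ⟨hu, hcut hu huw⟩ ⟨hv, hcut hv hvw⟩) huv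
  · have hdis : connectedComponentIn (G.induce B).drawingᶜ x ⊆ G.drawingᶜ := by
      rw [drawing_eq_union (G := G) (B := B)]
      exact fun y hy h => h.elim (connectedComponentIn_subset _ _ hy) fun h => hne ⟨y, hy, h⟩
    have hxF := mem_connectedComponentIn (F := (G.induce B).drawingᶜ) hx
    have hface : G.IsFace (connectedComponentIn (G.induce B).drawingᶜ x) := by
      refine ⟨x, hdis hxF, subset_antisymm
        (isPreconnected_connectedComponentIn.subset_connectedComponentIn hxF hdis)
        (connectedComponentIn_mono _ (compl_subset_compl.2 ?_))⟩
      rw [drawing_eq_union (G := G) (B := B)]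
      exact subset_union_left
    exact (hG.1 _ hface hb).induce hfr
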